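/- Let S⃗ be a finite submodular separation system inside a universe of separations, let 𝒫 be a set of profiles of S, and let M ⊆ S be a nested set of separations, each good for 𝒫, such that all profiles in 𝒫 contain exactly the same orientations of the elements of M. Let P and P' be two distinct profiles in 𝒫 with E_P ≠ ∅ ≠ E_{P'}, and let r_P and r_{P'} be the unique maximal elements of E_P and E_{P'} respectively. Then the underlying separations of r_P and r_{P'} are nested. -/

import Mathlib

namespace SepSys

variable {U : Type*} [Lattice U]

/-- `inv` is an order-reversing involution on the universe `U`. -/
def IsInvol (inv : U → U) : Prop :=
  (∀ s, inv (inv s) = s) ∧ ∀ r s : U, r ≤ s → inv s ≤ inv r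

/-- `Sv` is a separation system inside the universe `U`: a subset closed under the involution. -/
def IsSepSys (inv : U → U) (Sv : Set U) : Prop :=
  ∀ s ∈ Sv, inv s ∈ Sv

/-- structural submodularity of a separation system inside a universe -/
def SubmodularSys (Sv : Set U) : Prop :=
  ∀ r ∈ Sv, ∀ s ∈ Sv, r ⊔ s ∈ Sv ∨ r ⊓ s ∈ Sv

/-- the (unoriented) separations underlying `r` and `s` are nested -/
def Nested (inv : U → U) (r s : U) : Prop :=
  r ≤ s ∨ r ≤ inv s ∨ inv r ≤ s ∨ inv r ≤ inv s

def NestedSet (inv : U → U) (N : Set U) : Prop :=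
  ∀ r ∈ N, ∀ s ∈ N, Nested inv r s

def NestedWithAll (inv : U → U) (M : Set U) (s : U) : Prop :=
  ∀ m ∈ M, Nested inv s m

/-- `N` represents a set of unoriented separations of `Sv`:
we represent such a set by the set of all orientations of its elements. -/
def UnorientedIn (inv : U → U) (Sv N : Set U) : Prop :=
  N ⊆ Sv ∧ ∀ s ∈ N, inv s ∈ N

/-- `O` is an orientation of (the set of unoriented separations of) `Sv` -/
def IsOrientation (inv : U → U) (Sv O : Set U) : Prop :=
  O ⊆ Sv ∧ (∀ s ∈ Sv, s ∈ O ∨ inv s ∈ O) ∧ ∀ s ∈ O, inv s ∈ O → inv s = s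

def Consistent (inv : U → U) (O : Set U) : Prop :=
  ∀ a ∈ O, ∀ b ∈ O, a ≠ b → ¬ inv a < b

def IsProfile (inv : U → U) (Sv P : Set U) : Prop :=
  IsOrientation inv Sv P ∧ Consistent inv P ∧ ∀ r ∈ P, ∀ s ∈ P, inv (r ⊔ s) ∉ P

def IsStarIn (inv : U → U) (Sv σ : Set U) : Prop :=
  σ ⊆ Sv ∧ (∀ s ∈ σ, inv s ≠ s) ∧ ∀ r ∈ σ, ∀ s ∈ σ, r ≠ s → r ≤ inv s

def IsFTangle (inv : U → U) (Sv : Set U) (F : Set (Set U)) (O : Set U) : Prop :=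
  IsOrientation inv Sv O ∧ Consistent inv O ∧ ∀ σ ∈ F, ¬ σ ⊆ O

/-- the non-degenerate separation underlying `s` distinguishes `O` and `O'` -/
def Distinguishes (inv : U → U) (s : U) (O O' : Set U) : Prop :=
  inv s ≠ s ∧ ((s ∈ O ∧ inv s ∈ O') ∨ (inv s ∈ O ∧ s ∈ O'))

def DistinguishesAll (inv : U → U) (N : Set U) (Ps : Set (Set U)) : Prop :=
  ∀ P ∈ Ps, ∀ P' ∈ Ps, P ≠ P' → ∃ s ∈ N, Distinguishes inv s P P'

def CloselyRelated (inv : U → U) (Sv O : Set U) (s : U) : Prop :=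
  s ∈ O ∧ ∀ r ∈ O, s ⊓ r ∈ Sv

def DistinguishesWell (inv : U → U) (Sv P P' : Set U) (s : U) : Prop :=
  (CloselyRelated inv Sv P s ∧ CloselyRelated inv Sv P' (inv s)) ∨
    (CloselyRelated inv Sv P' s ∧ CloselyRelated inv Sv P (inv s))

def GoodFor (inv : U → U) (Sv : Set U) (Ps : Set (Set U)) (s : U) : Prop :=
  ∃ P ∈ Ps, ∃ P' ∈ Ps, P ≠ P' ∧ DistinguishesWell inv Sv P P' s

def MaxElems (O : Set U) : Set U :=
  {x ∈ O | ∀ y ∈ O, x ≤ y → x = y}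

/-- `σ` is a node of the nested set `N` (represented with all orientations of its elements) -/
def IsNode (inv : U → U) (N σ : Set U) : Prop :=
  IsStarIn inv N σ ∧ ∃ O, IsOrientation inv N O ∧ Consistent inv O ∧ σ = MaxElems O

def IsTrivialIn (inv : U → U) (Sv : Set U) (s : U) : Prop :=
  ∃ r ∈ Sv, ({r, inv r} : Set U) ≠ {s, inv s} ∧ s < r ∧ s < inv r

def SmallSep (inv : U → U) (s : U) : Prop := s ≤ inv s

def StandardSet (inv : U → U) (Sv : Set U) (F : Set (Set U)) : Prop :=
  ∀ s ∈ Sv, IsTrivialIn inv Sv s → ({inv s} : Set U) ∈ F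

def Emulates (inv : U → U) (Sv : Set U) (r s : U) : Prop :=
  r ≤ s ∧ ∀ x ∈ Sv, r ≤ x → x ≠ inv r → s ⊔ x ∈ Sv

open Classical in
/-- the shifting map `f↓` -/
noncomputable def shiftMap (inv : U → U) (r s x : U) : U :=
  if r ≤ x then x ⊔ s else inv (inv x ⊔ s)

def ClosedUnderShifting (inv : U → U) (Sv : Set U) (F : Set (Set U)) : Prop :=
  ∀ r ∈ Sv, ∀ s ∈ Sv, inv r ≠ r → ¬ IsTrivialIn inv Sv r → Emulates inv Sv r s →
    ∀ σ ∈ F, (∀ x ∈ σ, x ∈ Sv ∧ (r ≤ x ∨ r ≤ inv x) ∧ x ≠ inv r) →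
      (∃ t ∈ σ, r ≤ t) → shiftMap inv r s '' σ ∈ F

def Friendly (inv : U → U) (Sv : Set U) (F : Set (Set U)) : Prop :=
  (∀ σ ∈ F, IsStarIn inv Sv σ) ∧ StandardSet inv Sv F ∧
    ClosedUnderShifting inv Sv F ∧
    (∀ s ∈ Sv, SmallSep inv s → ({inv s} : Set U) ∈ F) ∧
    ∀ O, IsFTangle inv Sv F O → IsProfile inv Sv O

def IsAut (inv : U → U) (Sv : Set U) (φ : U → U) : Prop :=
  Set.BijOn φ Sv Sv ∧ (∀ r ∈ Sv, ∀ s ∈ Sv, (r ≤ s ↔ φ r ≤ φ s)) ∧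
    ∀ s ∈ Sv, φ (inv s) = inv (φ s)

/-- the separations of `Sv` that are nested with all separations in `M` -/
def SvM (inv : U → U) (Sv M : Set U) : Set U :=
  {s ∈ Sv | NestedWithAll inv M s}

/-- the set `E_P` of `P`-exclusive separations in `P_M` distinguishing `P` well
from some other profile in `Ps` -/
def EP (inv : U → U) (Sv M : Set U) (Ps : Set (Set U)) (P : Set U) : Set U :=
  {s ∈ P ∩ SvM inv Sv M | (∀ P' ∈ Ps, s ∈ P' → P' = P) ∧
    ∃ P' ∈ Ps, P' ≠ P ∧ DistinguishesWell inv Sv P P' s}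

/-- the set `M_{P,i}` from the construction of the canonical nested set:
separations nested with the previously chosen set `N` that are `P`-exclusive
for the remaining profiles `Q` and maximal in `P ∩ S⃗_i` -/
def MpOf (inv : U → U) (Sv N : Set U) (Q : Set (Set U)) (P : Set U) : Set U :=
  {s ∈ SvM inv Sv N | s ∈ P ∧ (∀ P' ∈ Q, s ∈ P' → P' = P) ∧
    ∀ x ∈ P ∩ SvM inv Sv N, s ≤ x → s = x}

def QiOf (inv : U → U) (Sv N : Set U) (Q : Set (Set U)) : Set (Set U) :=
  {P ∈ Q | (MpOf inv Sv N Q P).Nonempty}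

/-- step `i` of the construction: the pair `(N_i, Ps_{≥ i+1})` -/
def constrStep (inv : U → U) (Sv : Set U) (Ps : Set (Set U)) : ℕ → Set U × Set (Set U)
  | 0 => (∅, Ps)
  | (i+1) =>
      let p := constrStep inv Sv Ps i
      (p.1 ∪ {x | ∃ P ∈ QiOf inv Sv p.1 p.2, ∃ y,
          IsGLB (MpOf inv Sv p.1 p.2 P) y ∧ (x = y ∨ x = inv y)},
        p.2 \ QiOf inv Sv p.1 p.2)

/-- the least `K` such that `Ps_{≥ K+1}` contains at most one profile -/
noncomputable def stopIndex (inv : U → U) (Sv : Set U) (Ps : Set (Set U)) : ℕ :=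
  sInf {i | ((constrStep inv Sv Ps i).2).Subsingleton}

/-- the canonical nested set `N(S⃗, Ps)` -/
noncomputable def canonicalN (inv : U → U) (Sv : Set U) (Ps : Set (Set U)) : Set U :=
  (constrStep inv Sv Ps (stopIndex inv Sv Ps)).1

end SepSys

open SepSys

namespace SepSys

variable {U : Type*} [Lattice U] {inv : U → U} {Sv : Set U}

theorem IsInvol.le_inv_comm (hinv : IsInvol inv) {a b : U} (h : a ≤ inv b) : b ≤ inv a := by
  have := hinv.2 _ _ h
  rwa [hinv.1] at this

theorem IsInvol.inv_le_comm (hinv : IsInvol inv) {a b : U} (h : inv a ≤ b) : inv b ≤ a := by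
  have := hinv.2 _ _ h
  rwa [hinv.1] at this

theorem IsInvol.inv_sup (hinv : IsInvol inv) (a b : U) : inv (a ⊔ b) = inv a ⊓ inv b := by
  apply le_antisymm
  · exact le_inf (hinv.2 _ _ le_sup_left) (hinv.2 _ _ le_sup_right)
  · exact hinv.le_inv_comm (sup_le (hinv.le_inv_comm inf_le_left) (hinv.le_inv_comm inf_le_right))

theorem IsInvol.inv_inf (hinv : IsInvol inv) (a b : U) : inv (a ⊓ b) = inv a ⊔ inv b := by
  have h := hinv.inv_sup (inv a) (inv b)
  rw [hinv.1, hinv.1] at h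
  rw [← h, hinv.1]

variable {P Q : Set U}

/-- Profiles are down-closed, except that they may contain the inverse of a small separation. -/
theorem IsProfile.mem_of_le (hinv : IsInvol inv) (hP : IsProfile inv Sv P) {b c : U}
    (hb : b ∈ P) (hc : c ∈ Sv) (hcb : c ≤ b) : c ∈ P ∨ c = inv b := by
  rcases hP.1.2.1 c hc with h | h
  · exact Or.inl h
  · by_cases hne : inv c = b
    · exact Or.inr (by rw [← hne, hinv.1])
    · by_cases hcb' : c = b
      · exact Or.inl (hcb' ▸ hb)
      · refine absurd ?_ (hP.2.1 _ h b hb hne)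
        rw [hinv.1]
        exact lt_of_le_of_ne hcb hcb'

theorem IsProfile.inf_mem (hinv : IsInvol inv) (hP : IsProfile inv Sv P) {a b : U}
    (ha : a ∈ P) (hb : b ∈ P) (hab : a ⊓ b ∈ Sv) : a ⊓ b ∈ P := by
  rcases hP.mem_of_le hinv ha hab inf_le_left with h | h
  · exact h
  rcases hP.mem_of_le hinv hb hab inf_le_right with h' | h'
  · exact h'
  have hEq : a = b := by rw [← hinv.1 a, ← h, h', hinv.1]
  rw [← hEq, inf_idem]
  exact ha

theorem IsProfile.sup_mem (hP : IsProfile inv Sv P) {a b : U}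
    (ha : a ∈ P) (hb : b ∈ P) (hab : a ⊔ b ∈ Sv) : a ⊔ b ∈ P :=
  (hP.1.2.1 _ hab).resolve_right (hP.2.2 a ha b hb)

/-- A separation in `P` whose inverse is closely related to `Q` lies below one that moreover is
closely related to `P`. -/
theorem exists_ge_closelyRelated (hinv : IsInvol inv) (hfin : Sv.Finite)
    (hsys : IsSepSys inv Sv) (hsub : SubmodularSys Sv)
    (hP : IsProfile inv Sv P) (hQ : IsProfile inv Sv Q) {u : U} (huP : u ∈ P)
    (huQ : CloselyRelated inv Sv Q (inv u)) :
    ∃ v, u ≤ v ∧ CloselyRelated inv Sv P v ∧ CloselyRelated inv Sv Q (inv v) := by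
  have hfinD : {v | v ∈ P ∧ CloselyRelated inv Sv Q (inv v)}.Finite :=
    hfin.subset fun v hv => hP.1.1 hv.1
  obtain ⟨v, huv, ⟨hvP, hvQ⟩, hvmax⟩ := hfinD.exists_le_maximal (a := u) ⟨huP, huQ⟩
  refine ⟨v, huv, ⟨hvP, ?_⟩, hvQ⟩
  by_contra! hbad
  obtain ⟨t₀, ht₀P, ht₀⟩ := hbad
  have hvS : v ∈ Sv := hP.1.1 hvP
  have hsup : ∀ t ∈ Sv, v ⊓ t ∉ Sv → v ⊔ t ∈ Sv := fun t ht h =>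
    (hsub v hvS t ht).resolve_right h
  -- Admitting `t` merely below an element of `P` takes care of inverses of small separations.
  have hfinT : {t | t ∈ Sv ∧ v ⊓ t ∉ Sv ∧ ∃ p ∈ P, t ≤ p ∧ v ⊔ p ∈ P}.Finite :=
    hfin.subset fun t ht => ht.1
  have ht₀S := hP.1.1 ht₀P
  obtain ⟨t, -, ⟨htS, hvt, p, hpP, htp, hvp⟩, htmin⟩ := hfinT.exists_le_minimal (a := t₀)
    ⟨ht₀S, ht₀, t₀, ht₀P, le_rfl, hP.sup_mem hvP ht₀P (hsup _ ht₀S ht₀)⟩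
  have hvtS : v ⊔ t ∈ Sv := hsup t htS hvt
  have hvtP : v ⊔ t ∈ P := by
    rcases hP.mem_of_le hinv hpP htS htp with h | h
    · exact hP.sup_mem hvP h hvtS
    · rcases hP.mem_of_le hinv hvp hvtS (sup_le_sup_left htp v) with h' | h'
      · exact h'
      · have hle : v ≤ t := by
          calc v ≤ v ⊔ t := le_sup_left
            _ = inv v ⊓ inv p := by rw [h', hinv.inv_sup]
            _ ≤ inv p := inf_le_right
            _ = t := h.symm
        exact absurd (by rwa [inf_eq_left.2 hle]) hvt
  have hnle : ¬ t ≤ v := fun h => hvt (by rwa [inf_eq_right.2 h])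
  have hinvQ : inv (v ⊔ t) ∈ Q := by
    rcases hQ.mem_of_le hinv hvQ.1 (hsys _ hvtS) (hinv.2 _ _ le_sup_left) with h | h
    · exact h
    · have h1 : v ⊔ t = inv v := by
        rw [← hinv.1 (v ⊔ t), h, hinv.1]
      have h2 : inv v = v := hP.1.2.2 v hvP (h1 ▸ hvtP)
      exact absurd (le_sup_right.trans (h1.trans h2).le) hnle
  have hnot : ¬ CloselyRelated inv Sv Q (inv (v ⊔ t)) := fun h =>
    hnle (le_sup_right.trans (hvmax ⟨hvtP, h⟩ le_sup_left))
  obtain ⟨z, hzQ, hz⟩ : ∃ z ∈ Q, inv (v ⊔ t) ⊓ z ∉ Sv := by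
    by_contra! h
    exact hnot ⟨hinvQ, h⟩
  have hyS : inv v ⊓ z ∈ Sv := hvQ.2 z hzQ
  have hty : inv t ⊓ (inv v ⊓ z) ∉ Sv := by
    rwa [← inf_assoc, inf_comm (inv t), ← hinv.inv_sup]
  have hjoin : inv t ⊔ (inv v ⊓ z) ∈ Sv := (hsub _ (hsys _ htS) _ hyS).resolve_right hty
  have hmeet : t ⊓ inv (inv v ⊓ z) ∈ Sv := by
    have := hsys _ hjoin
    rwa [hinv.inv_sup, hinv.1] at this
  have hvy : v ≤ inv (inv v ⊓ z) := hinv.le_inv_comm inf_le_left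
  have heq : v ⊓ (t ⊓ inv (inv v ⊓ z)) = v ⊓ t := by
    rw [← inf_assoc]
    exact inf_eq_left.2 (inf_le_left.trans hvy)
  have hle : t ≤ t ⊓ inv (inv v ⊓ z) :=
    htmin ⟨hmeet, by rwa [heq], p, hpP, inf_le_left.trans htp, hvp⟩ inf_le_left
  refine hty ?_
  rw [inf_eq_right.2 (hinv.le_inv_comm (hle.trans inf_le_right))]
  exact hyS

/-- If some separation nested with `m` distinguishes two profiles, then `m` is not degenerate. -/
theorem inv_ne_of_nested (hinv : IsInvol inv) (hP : IsProfile inv Sv P) (hQ : IsProfile inv Sv Q)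
    {m r : U} (hmP : m ∈ P) (hmQ : m ∈ Q) (hrP : r ∈ P) (hrQ : r ∉ Q)
    (hnest : Nested inv r m) : inv m ≠ m := by
  intro hm
  have hne : m ≠ r := fun h => hrQ (h ▸ hmQ)
  have hrQ' : inv r ∈ Q := (hQ.1.2.1 r (hP.1.1 hrP)).resolve_left hrQ
  have hcmp : r ≤ m ∨ m ≤ r := by
    rcases hnest with h | h | h | h
    · exact Or.inl h
    · exact Or.inl (hm ▸ h)
    · exact Or.inr (hm ▸ hinv.inv_le_comm h)
    · exact Or.inr (hm ▸ hinv.inv_le_comm (hm ▸ h))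
  rcases hcmp with h | h
  · have hne' : m ≠ inv r := fun h' => hne (by rw [← hm, h', hinv.1])
    refine hQ.2.1 m hmQ _ hrQ' hne' (lt_of_le_of_ne (hinv.2 _ _ h) ?_)
    rwa [hm]
  · refine hP.2.1 m hmP r hrP hne ?_
    rw [hm]
    exact lt_of_le_of_ne h hne

theorem inv_eq_of_goodFor_of_agree {Ps : Set (Set U)} (hPs : ∀ P ∈ Ps, IsProfile inv Sv P)
    {M : Set U} (hMagree : ∀ P ∈ Ps, ∀ P' ∈ Ps, P ∩ M = P' ∩ M)
    {m : U} (hm : m ∈ M) (hgood : GoodFor inv Sv Ps m) :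
    inv m = m ∧ ∀ P ∈ Ps, m ∈ P := by
  obtain ⟨A, hA, B, hB, -, hAB⟩ := hgood
  have key : ∀ A ∈ Ps, ∀ B ∈ Ps, m ∈ A → m ∈ B := fun A hA B hB h => by
    have h' : m ∈ A ∩ M := ⟨h, hm⟩
    rw [hMagree A hA B hB] at h'
    exact h'.1
  rcases hAB with ⟨h1, h2⟩ | ⟨h1, h2⟩
  · exact ⟨(hPs B hB).1.2.2 m (key A hA B hB h1.1) h2.1, fun C hC => key A hA C hC h1.1⟩
  · exact ⟨(hPs A hA).1.2.2 m (key B hB A hA h1.1) h2.1, fun C hC => key B hB C hC h1.1⟩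

theorem exists_closelyRelated_of_mem_EP {Ps : Set (Set U)} {M : Set U} {r : U}
    (hr : r ∈ EP inv Sv M Ps P) :
    CloselyRelated inv Sv P r ∧ ∃ Q ∈ Ps, Q ≠ P ∧ CloselyRelated inv Sv Q (inv r) := by
  obtain ⟨-, hex, Q, hQ, hQP, ⟨h1, h2⟩ | ⟨h1, -⟩⟩ := hr
  · exact ⟨h1, Q, hQ, hQP, h2⟩
  · exact absurd (hex Q hQ h1.1) hQP

end SepSys

theorem rP_nested {U : Type*} [Lattice U] (inv : U → U) (Sv : Set U)
    (hinv : IsInvol inv) (hfin : Sv.Finite) (hsys : IsSepSys inv Sv)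
    (hsub : SubmodularSys Sv)
    (Ps : Set (Set U)) (hPs : ∀ P ∈ Ps, IsProfile inv Sv P)
    (M : Set U) (hM : UnorientedIn inv Sv M) (hMnested : NestedSet inv M)
    (hMgood : ∀ m ∈ M, GoodFor inv Sv Ps m)
    (hMagree : ∀ P ∈ Ps, ∀ P' ∈ Ps, P ∩ M = P' ∩ M)
    (P P' : Set U) (hP : P ∈ Ps) (hP' : P' ∈ Ps) (hPP' : P ≠ P')
    (rP rP' : U) (hrP : Maximal (· ∈ EP inv Sv M Ps P) rP)
    (hrP' : Maximal (· ∈ EP inv Sv M Ps P') rP') :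
    Nested inv rP rP' := by
  have hex := hrP.1.2.1
  have hrP_mem : rP ∈ P := hrP.1.1.1
  obtain ⟨hrP_S, hrP_M⟩ := hrP.1.1.2
  obtain ⟨hrel, Q, hQ, hQP, hrelQ⟩ := exists_closelyRelated_of_mem_EP hrP.1
  obtain ⟨hrel', -⟩ := exists_closelyRelated_of_mem_EP hrP'.1
  have hex' := hrP'.1.2.1
  have hM_empty : ∀ m, m ∉ M := fun m hm => by
    obtain ⟨hdeg, hmem⟩ := inv_eq_of_goodFor_of_agree hPs hMagree hm (hMgood m hm)
    exact inv_ne_of_nested hinv (hPs P hP) (hPs P' hP') (hmem P hP) (hmem P' hP') hrP_mem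
      (fun h => hPP' (hex P' hP' h).symm) (hrP_M m hm) hdeg
  have hinv_mem : ∀ R ∈ Ps, R ≠ P → inv rP ∈ R := fun R hR hRP =>
    ((hPs R hR).1.2.1 rP hrP_S).resolve_left fun h => hRP (hex R hR h)
  have htransfer : ∀ R ∈ Ps, R ≠ P → ∀ R' ∈ Ps, R' ≠ P → ∀ y ∈ R, y ≤ inv rP → y ∈ R' := by
    intro R hR hRP R' hR' hRP' y hy hyr
    rcases (hPs R' hR').mem_of_le hinv (hinv_mem R' hR' hRP') ((hPs R hR).1.1 hy) hyr with h | h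
    · exact h
    · rw [hinv.1] at h
      exact absurd (hex R hR (h ▸ hy)) hRP
  have hsP' : rP' ∈ P' := hrel'.1
  have hsP : inv rP' ∈ P :=
    ((hPs P hP).1.2.1 rP' ((hPs P' hP').1.1 hsP')).resolve_left fun h => hPP' (hex' P hP h)
  have hcorner : rP' ⊓ inv rP ∈ Sv := hrel'.2 _ (hinv_mem P' hP' hPP'.symm)
  have hinv_join : inv (rP ⊔ inv rP') = rP' ⊓ inv rP := by
    rw [hinv.inv_sup, hinv.1, inf_comm]
  have hjoinS : rP ⊔ inv rP' ∈ Sv := by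
    have := hsys _ hcorner
    rwa [← hinv_join, hinv.1] at this
  have hjoinP : rP ⊔ inv rP' ∈ P := (hPs P hP).sup_mem hrP_mem hsP hjoinS
  have hjoinQ : CloselyRelated inv Sv Q (inv (rP ⊔ inv rP')) := by
    rw [hinv_join]
    refine ⟨htransfer P' hP' hPP'.symm Q hQ hQP _ ((hPs P' hP').inf_mem hinv hsP'
      (hinv_mem P' hP' hPP'.symm) hcorner) inf_le_right, fun x hx => ?_⟩
    rw [inf_assoc]
    exact hrel'.2 _ (htransfer Q hQ hQP P' hP' hPP'.symm _
      ((hPs Q hQ).inf_mem hinv hrelQ.1 hx (hrelQ.2 x hx)) inf_le_left)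
  obtain ⟨v, hjv, hvP, hvQ⟩ :=
    exists_ge_closelyRelated hinv hfin hsys hsub (hPs P hP) (hPs Q hQ) hjoinP hjoinQ
  have hrv : rP ≤ v := le_sup_left.trans hjv
  have hvex : ∀ R ∈ Ps, v ∈ R → R = P := by
    intro R hR hvR
    by_contra hRP
    rcases (hPs R hR).mem_of_le hinv hvR hrP_S hrv with h | h
    · exact hRP (hex R hR h)
    · have hv : inv rP = v := by rw [h, hinv.1]
      have hdeg : inv rP = rP := (hPs P hP).1.2.2 rP hrP_mem (hv ▸ hvP.1)
      exact hRP (hex R hR (by rwa [← hdeg, hv]))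
  have hvE : v ∈ EP inv Sv M Ps P :=
    ⟨⟨hvP.1, (hPs P hP).1.1 hvP.1, fun m hm => absurd hm (hM_empty m)⟩, hvex, Q, hQ, hQP,
      Or.inl ⟨hvP, hvQ⟩⟩
  have hvr : v ≤ rP := hrP.2 hvE hrv
  exact Or.inr (Or.inr (Or.inl (hinv.inv_le_comm (le_sup_right.trans (hjv.trans hvr)))))
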